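/- (Lemma 1 of the paper.) Let all edge weights satisfy w u v ≥ δ for a fixed real δ > 0, assume every vertex is reachable from the source s (d(v) < ∞ for all v), and let v_1, …, v_n be a bijective enumeration of V with v_1 = s that is a δ-partial-ordering (i < j implies d(v_i) < d(v_j) + δ). Fix an index j with 1 ≤ j ≤ n, and suppose that D_i(v_i) = d(v_i) for every i < j. Then D_j(v_j) = d(v_j). -/

import Mathlib

open scoped ENNReal

/-- The length of the path `p 0, p 1, …, p k` in a graph on `Fin n` with
edge-weight function `w` (where `w u v = ∞` encodes the absence of an edge). -/
noncomputable def pathCost {n : ℕ} (w : Fin n → Fin n → ℝ≥0∞) (p : ℕ → Fin n) (k : ℕ) : ℝ≥0∞ :=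
  ∑ i ∈ Finset.range k, w (p i) (p (i + 1))

/-- The shortest-path distance from `s` to `v`: the infimum over all finite paths
from `s` to `v` of their lengths. -/
noncomputable def spDist {n : ℕ} (w : Fin n → Fin n → ℝ≥0∞) (s v : Fin n) : ℝ≥0∞ :=
  ⨅ (k : ℕ) (p : ℕ → Fin n) (_ : p 0 = s) (_ : p k = v), pathCost w p k

/-- Dijkstra's label recursion, processed according to the enumeration `e` (0-indexed):
`dijkstraD w s e 0` is the initial labelling (`0` at `s`, `∞` elsewhere), and step `j`
relaxes all edges out of the extracted vertex `e j`.  The paper's `D_j` is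
`dijkstraD w s e (j-1)`; the extraction value of `v_j` is `dijkstraD w s e (j-1) (e (j-1))`. -/
noncomputable def dijkstraD {n : ℕ} (w : Fin n → Fin n → ℝ≥0∞) (s : Fin n) (e : Fin n → Fin n) :
    ℕ → Fin n → ℝ≥0∞
  | 0 => fun u => if u = s then 0 else ⊤
  | j + 1 => fun u =>
      if h : j < n then
        min (dijkstraD w s e j u) (dijkstraD w s e j (e ⟨j, h⟩) + w (e ⟨j, h⟩) u)
      else dijkstraD w s e j u

theorem spDist_le_pathCost {n : ℕ} (w : Fin n → Fin n → ℝ≥0∞) (p : ℕ → Fin n) (k : ℕ) :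
    spDist w (p 0) (p k) ≤ pathCost w p k :=
  iInf_le_of_le k <| iInf_le_of_le p <| iInf_le_of_le rfl <| iInf_le_of_le rfl le_rfl

theorem pathCost_succ {n : ℕ} (w : Fin n → Fin n → ℝ≥0∞) (p : ℕ → Fin n) (k : ℕ) :
    pathCost w p (k + 1) = pathCost w p k + w (p k) (p (k + 1)) :=
  Finset.sum_range_succ _ _

@[simp]
theorem spDist_self {n : ℕ} (w : Fin n → Fin n → ℝ≥0∞) (s : Fin n) : spDist w s s = 0 :=
  le_antisymm (by simpa [pathCost] using spDist_le_pathCost w (fun _ => s) 0) zero_le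

theorem spDist_le_add {n : ℕ} (w : Fin n → Fin n → ℝ≥0∞) (s x v : Fin n) :
    spDist w s v ≤ spDist w s x + w x v := by
  conv_rhs => rw [spDist]
  simp only [ENNReal.iInf_add]
  refine le_iInf fun k => le_iInf fun p => le_iInf fun h0 => le_iInf fun hk => ?_
  have hcost : pathCost w (Function.update p (k + 1) v) k = pathCost w p k := by
    refine Finset.sum_congr rfl fun i hi => ?_
    have hik := Finset.mem_range.mp hi
    rw [Function.update_of_ne (by omega), Function.update_of_ne (by omega)]
  have h := spDist_le_pathCost w (Function.update p (k + 1) v) (k + 1)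
  rw [pathCost_succ, hcost] at h
  simpa [h0, hk] using h

/-- Away from the source, the distance is attained by extending a shortest path to some
predecessor. -/
theorem exists_spDist_add_le {n : ℕ} (w : Fin n → Fin n → ℝ≥0∞) {s v : Fin n} (hv : v ≠ s) :
    ∃ x, spDist w s x + w x v ≤ spDist w s v := by
  have : Nonempty (Fin n) := ⟨s⟩
  obtain ⟨x, hx⟩ := Finite.exists_min fun x => spDist w s x + w x v
  refine ⟨x, le_iInf fun k => le_iInf fun p => le_iInf fun h0 => le_iInf fun hk => ?_⟩
  cases k with
  | zero => exact absurd (hk.symm.trans h0) hv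
  | succ k =>
    rw [pathCost_succ, hk]
    refine (hx (p k)).trans ?_
    gcongr
    exact h0 ▸ spDist_le_pathCost w p k

theorem spDist_le_dijkstraD {n : ℕ} (w : Fin n → Fin n → ℝ≥0∞) (s : Fin n)
    (e : Fin n → Fin n) (k : ℕ) (u : Fin n) : spDist w s u ≤ dijkstraD w s e k u := by
  induction k generalizing u with
  | zero =>
    by_cases hu : u = s <;> simp [dijkstraD, hu]
  | succ k ih =>
    rw [dijkstraD]
    split_ifs with h
    · refine le_min (ih u) ((spDist_le_add w s (e ⟨k, h⟩) u).trans ?_)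
      gcongr
      exact ih _
    · exact ih u

theorem dijkstraD_antitone {n : ℕ} (w : Fin n → Fin n → ℝ≥0∞) (s : Fin n)
    (e : Fin n → Fin n) (u : Fin n) : Antitone fun k => dijkstraD w s e k u := by
  refine antitone_nat_of_succ_le fun k => ?_
  simp only [dijkstraD]
  split_ifs
  · exact min_le_left _ _
  · exact le_rfl

theorem dijkstraD_le_add {n : ℕ} (w : Fin n → Fin n → ℝ≥0∞) (s : Fin n)
    (e : Fin n → Fin n) (i : Fin n) {k : ℕ} (hik : i.val < k) (u : Fin n) :
    dijkstraD w s e k u ≤ dijkstraD w s e i.val (e i) + w (e i) u := by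
  refine (dijkstraD_antitone w s e u (Nat.succ_le_of_lt hik)).trans ?_
  simp [dijkstraD]

/-- Lemma 1: if all edge weights are at least `δ > 0`, every vertex is reachable from `s`,
the enumeration `e` is bijective, starts at `s`, and is a δ-partial-ordering, and
Dijkstra's extraction values are correct for all indices `i < j`, then the extraction
value at index `j` is also correct: `D_j (v_j) = d (v_j)`. -/
theorem dijkstra_step_correct {n : ℕ} (hn : 0 < n) (w : Fin n → Fin n → ℝ≥0∞) (s : Fin n)
    (δ : ℝ) (hδ : 0 < δ) (hw : ∀ u v : Fin n, ENNReal.ofReal δ ≤ w u v)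
    (hreach : ∀ v : Fin n, spDist w s v < ⊤)
    (e : Fin n → Fin n) (he : Function.Bijective e) (hes : e ⟨0, hn⟩ = s)
    (hPO : ∀ i j : Fin n, i < j → spDist w s (e i) < spDist w s (e j) + ENNReal.ofReal δ)
    (j : Fin n)
    (hprev : ∀ i : Fin n, i < j → dijkstraD w s e i.val (e i) = spDist w s (e i)) :
    dijkstraD w s e j.val (e j) = spDist w s (e j) := by
  refine le_antisymm ?_ (spDist_le_dijkstraD w s e j.val (e j))
  by_cases hj : e j = s
  · have hj0 : j = ⟨0, hn⟩ := he.injective (hj.trans hes.symm)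
    simp [hj0, hes, dijkstraD]
  obtain ⟨x, hx⟩ := exists_spDist_add_le w hj
  obtain ⟨i, rfl⟩ := he.surjective x
  rcases lt_or_ge i j with hij | hji
  · refine (dijkstraD_le_add w s e i hij (e j)).trans ?_
    rwa [hprev i hij]
  · have hlt : spDist w s (e j) < spDist w s (e i) + ENNReal.ofReal δ := by
      rcases hji.eq_or_lt with rfl | hji
      · exact ENNReal.lt_add_right (hreach _).ne (ENNReal.ofReal_pos.mpr hδ).ne'
      · exact hPO j i hji
    refine absurd (hx.trans_lt hlt) (not_lt_of_ge ?_)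
    gcongr
    exact hw _ _
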